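/- arXiv:1011.4353 — 3 statements merged into one kernel-verified Lean document; each statement's English description precedes it below -/
import Mathlib

section
/- Let K be a field of characteristic 0. For j = 1, 2, let V_j be a finite-dimensional K-vector space, W_•V_j a finite increasing filtration of V_j by K-subspaces, and N_j a nilpotent K-linear endomorphism of V_j with N_j(W_wV_j) ⊆ W_wV_j for all w ∈ ℤ. Assume that for j = 1, 2 there is a relative monodromy filtration M_•V_j of N_j with respect to W_•V_j. Then the filtration M_•V₁ ⊗ M_•V₂ of V₁ ⊗_K V₂ is a relative monodromy filtration of the endomorphism N₁ ⊗ id + id ⊗ N₂ with respect to W_•V₁ ⊗ W_•V₂. -/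
open TensorProduct

/-- `M` is a relative monodromy filtration of the endomorphism `N` with respect to the
increasing filtration `W`: `M` is increasing, `N M_w ⊆ M_{w-2}`, and for all `w` and `m ≥ 0`
the map `gr^M_{w+m} gr^W_w → gr^M_{w-m} gr^W_w` induced by `N^m` is an isomorphism
(expressed elementwise on representatives). -/
def IsRelMonodromyFiltration {R V : Type*} [Ring R] [AddCommGroup V] [Module R V]
    (N : Module.End R V) (W M : ℤ → Submodule R V) : Prop :=
  Monotone M ∧
  (∀ w : ℤ, ∀ x ∈ M w, N x ∈ M (w - 2)) ∧
  ∀ (w : ℤ) (m : ℕ),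
    (∀ x ∈ M (w - (m : ℤ)) ⊓ W w, ∃ y ∈ M (w + (m : ℤ)) ⊓ W w,
      x - (N ^ m) y ∈ M (w - (m : ℤ) - 1) ⊔ W (w - 1)) ∧
    (∀ y ∈ M (w + (m : ℤ)) ⊓ W w, (N ^ m) y ∈ M (w - (m : ℤ) - 1) ⊔ W (w - 1) →
      y ∈ M (w + (m : ℤ) - 1) ⊔ W (w - 1))

/-- A finite increasing filtration: increasing, `⊥` for small degrees, `⊤` for large degrees. -/
def IsFiniteFiltration {R V : Type*} [Ring R] [AddCommGroup V] [Module R V]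
    (W : ℤ → Submodule R V) : Prop :=
  Monotone W ∧ (∃ a : ℤ, ∀ w : ℤ, w ≤ a → W w = ⊥) ∧ ∃ b : ℤ, ∀ w : ℤ, b ≤ w → W w = ⊤

/-- The tensor product filtration `(W ⊗ W')_w = Σ_{j+k=w} W_j ⊗ W'_k`. -/
noncomputable def tensorFiltration (K : Type*) [Field K] {V₁ V₂ : Type*}
    [AddCommGroup V₁] [Module K V₁] [AddCommGroup V₂] [Module K V₂]
    (W₁ : ℤ → Submodule K V₁) (W₂ : ℤ → Submodule K V₂) (w : ℤ) :
    Submodule K (TensorProduct K V₁ V₂) :=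
  ⨆ j : ℤ, Submodule.map₂ (TensorProduct.mk K V₁ V₂) (W₁ j) (W₂ (w - j))

section Lefschetz

variable {K V : Type*} [Field K] [AddCommGroup V] [Module K V]

/-- `T` shifts the degree of the family `F` by `d`. -/
def ShiftsDegree (T : Module.End K V) (F : ℤ → Submodule K V) (d : ℤ) : Prop :=
  ∀ a b : ℤ, b = a + d → ∀ x ∈ F a, T x ∈ F b

lemma ShiftsDegree.pow_apply {T : Module.End K V} {F : ℤ → Submodule K V} {d : ℤ}
    (h : ShiftsDegree T F d) (m : ℕ) {a b : ℤ} (hb : b = a + m * d) {x : V} (hx : x ∈ F a) :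
    (T ^ m) x ∈ F b := by
  induction m generalizing b with
  | zero => simpa [hb] using hx
  | succ m ih =>
    rw [pow_succ', Module.End.mul_apply]
    refine h (a + m * d) b ?_ _ (ih rfl)
    rw [hb]; push_cast; ring

lemma commutator_pow_mem {f e : Module.End K V} {F Z : ℤ → Submodule K V}
    (hfF : ShiftsDegree f F (-2)) (hfZ : ShiftsDegree f Z (-2))
    (hfe : ∀ n : ℤ, ∀ x ∈ F n, e (f x) - f (e x) - (n : K) • x ∈ Z n)
    (j : ℕ) {n b : ℤ} (hb : b = n - 2 * j) {x : V} (hx : x ∈ F n) :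
    e ((f ^ (j + 1)) x) - (f ^ (j + 1)) (e x) - (((j : K) + 1) * (n - j)) • (f ^ j) x ∈ Z b := by
  induction j generalizing b with
  | zero => simpa [hb] using hfe n x hx
  | succ j ih =>
    have h1 := hfZ _ b (by rw [hb]; push_cast; ring) _ (ih rfl)
    have h2 := hfe b _ (hfF.pow_apply (j + 1) (b := b) (by rw [hb]; push_cast; ring) hx)
    have h3 := add_mem h1 h2
    convert h3 using 1
    simp only [pow_succ' f, Module.End.mul_apply, map_sub, map_smul, hb]
    push_cast
    module

/-- Injectivity half of hard Lefschetz for a family of subquotients with an action of an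
`sl₂`-pair. -/
lemma mem_of_pow_mem_of_commutator [CharZero K] {f e : Module.End K V} {F Z : ℤ → Submodule K V}
    (hfF : ShiftsDegree f F (-2)) (hfZ : ShiftsDegree f Z (-2))
    (heF : ShiftsDegree e F 2) (heZ : ShiftsDegree e Z 2)
    (hfe : ∀ n : ℤ, ∀ x ∈ F n, e (f x) - f (e x) - (n : K) • x ∈ Z n)
    {B : ℕ} (hB : ∀ n : ℤ, (B : ℤ) ≤ n → F n ≤ Z n)
    (m : ℕ) {y : V} (hy : y ∈ F m) (hfy : (f ^ m) y ∈ Z (-m)) : y ∈ Z m := by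
  induction h : B - m using Nat.strong_induction_on generalizing m y with
  | _ c ih =>
  by_cases hm : B ≤ m
  · exact hB _ (by exact_mod_cast hm) hy
  have hey : e y ∈ Z (m + 2) := by
    refine ih (B - (m + 2)) (by omega) (m + 2) (y := e y) (heF _ _ (by push_cast; ring) _ hy) ?_ rfl
    have h1 := commutator_pow_mem hfF hfZ hfe m (b := -m) (by ring) hy
    have h2 : e ((f ^ (m + 1)) y) ∈ Z (-m) := by
      refine heZ (-m - 2) _ (by ring) _ ?_
      rw [pow_succ', Module.End.mul_apply]
      exact hfZ _ _ (by ring) _ hfy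
    have h3 : (f ^ (m + 1)) (e y) ∈ Z (-m) := by
      convert sub_mem h2 h1 using 1
      simp
    rw [pow_succ', Module.End.mul_apply]
    exact hfZ _ _ (by push_cast; ring) _ h3
  have key : ∀ i ≤ m, (f ^ (m - i)) y ∈ Z (m - 2 * ((m - i : ℕ) : ℤ)) := by
    intro i hi
    induction i with
    | zero => simpa [two_mul] using hfy
    | succ i ihi =>
      obtain ⟨j, hj⟩ : ∃ j, m - i = j + 1 := ⟨m - i - 1, by omega⟩
      have hj' : m - (i + 1) = j := by omega
      have h0 := ihi (by omega)
      rw [hj] at h0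
      rw [hj']
      have h1 := commutator_pow_mem hfF hfZ hfe j rfl hy
      have h2 := heZ _ (m - 2 * (j : ℤ)) (by push_cast; ring) _ h0
      have h3 := hfZ.pow_apply (j + 1) (b := m - 2 * (j : ℤ)) (by push_cast; ring) hey
      have hne : ((j : K) + 1) * (((m : ℤ) : K) - j) ≠ 0 := by
        have hjm : j < m := by omega
        refine mul_ne_zero (by exact_mod_cast Nat.succ_ne_zero j) (sub_ne_zero.2 ?_)
        push_cast
        exact_mod_cast hjm.ne'
      rw [← Submodule.smul_mem_iff _ hne]
      convert sub_mem (sub_mem h2 h3) h1 using 1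
      abel
  simpa using key m le_rfl

lemma exists_linear_choice (A B C : Submodule K V) (T : Module.End K V)
    (h : ∀ x ∈ A, ∃ y ∈ B, x - T y ∈ C) :
    ∃ g : Module.End K V, ∀ x ∈ A, g x ∈ B ∧ x - T (g x) ∈ C := by
  let b := Module.Basis.ofVectorSpace K A
  choose y hyB hyC using fun i => h (b i) (b i).2
  obtain ⟨g, hg⟩ := LinearMap.exists_extend (b.constr K y)
  have hgb (i) : g (b i) = y i := by
    rw [← b.constr_basis K y i, ← hg]; rfl
  have key : (⊤ : Submodule K A) ≤
      (B.comap g ⊓ C.comap (LinearMap.id - T ∘ₗ g)).comap A.subtype := by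
    rw [← b.span_eq, Submodule.span_le]
    rintro _ ⟨i, rfl⟩
    simp [hgb, hyB, hyC]
  exact ⟨g, fun x hx => by simpa using key (x := ⟨x, hx⟩) trivial⟩

/-- The raising operator in degrees `n ≥ 0`, given one-sided inverses `g m` of `f ^ m`;
it vanishes in degrees `n ≥ B`. -/
noncomputable def raiseNonneg (f : Module.End K V) (g : ℕ → Module.End K V) (B : ℕ) (n : ℕ) :
    Module.End K V :=
  if B ≤ n then 0
  else (f * raiseNonneg f g B (n + 2) + ((n : K) + 2) • 1) * (g (n + 2) * f ^ (n + 1))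
termination_by B - n

/-- The raising operator in all degrees. -/
noncomputable def raiseDegree (f : Module.End K V) (g : ℕ → Module.End K V) (B : ℕ) :
    ℤ → Module.End K V
  | (n : ℕ) => raiseNonneg f g B n
  | Int.negSucc n => (f ^ (n + 1) * raiseNonneg f g B (n + 1) + ((n : K) + 1) • f ^ n) * g (n + 1)

section Raise

variable {f : Module.End K V} {F Z : ℤ → Submodule K V} {g : ℕ → Module.End K V} {B : ℕ}

lemma raiseNonneg_mem (hf : ShiftsDegree f F (-2))
    (hg : ∀ m : ℕ, ∀ x ∈ F (-m), g m x ∈ F m) (n : ℕ) {b : ℤ} (hb : b = n + 2)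
    {x : V} (hx : x ∈ F n) : raiseNonneg f g B n x ∈ F b := by
  induction n using raiseNonneg.induct (B := B) generalizing x b with
  | case1 n h => rw [raiseNonneg, if_pos h]; simp
  | case2 n h ih =>
    rw [raiseNonneg, if_neg h]
    have h1 : g (n + 2) ((f ^ (n + 1)) x) ∈ F ((n + 2 : ℕ) : ℤ) :=
      hg _ _ (hf.pow_apply _ (by push_cast; ring) hx)
    refine add_mem (hf _ _ (by rw [hb]; push_cast; ring) _ (ih rfl h1)) (Submodule.smul_mem _ _ ?_)
    rw [hb]
    exact_mod_cast h1

lemma raiseDegree_mem (hf : ShiftsDegree f F (-2))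
    (hg : ∀ m : ℕ, ∀ x ∈ F (-m), g m x ∈ F m) (n : ℤ)
    {x : V} (hx : x ∈ F n) : raiseDegree f g B n x ∈ F (n + 2) := by
  match n, hx with
  | (n : ℕ), hx => exact raiseNonneg_mem hf hg n rfl hx
  | Int.negSucc n, hx =>
    have h1 : g (n + 1) x ∈ F ((n + 1 : ℕ) : ℤ) := hg _ _ hx
    refine add_mem ?_ (Submodule.smul_mem _ _ ?_)
    · exact hf.pow_apply (n + 1) (by rw [Int.negSucc_eq]; push_cast; ring)
        (raiseNonneg_mem hf hg _ rfl h1)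
    · exact hf.pow_apply n (by rw [Int.negSucc_eq]; push_cast; ring) h1

lemma raiseNonneg_commutator
    (hfF : ShiftsDegree f F (-2)) (hfZ : ShiftsDegree f Z (-2))
    (hB : ∀ n : ℤ, (B : ℤ) ≤ n → F n ≤ Z n) (hgF : ∀ m : ℕ, ∀ x ∈ F (-m), g m x ∈ F m)
    (hgZ : ∀ m : ℕ, ∀ x ∈ Z (-m), g m x ∈ Z m)
    (hgf : ∀ m : ℕ, ∀ y ∈ F m, g m ((f ^ m) y) - y ∈ Z m)
    (n : ℕ) {b : ℤ} (hb : b = n + 2) {y : V} (hy : y ∈ F b) :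
    raiseNonneg f g B n (f y) - f (raiseNonneg f g B (n + 2) y) - ((n : K) + 2) • y ∈ Z b := by
  by_cases h : B ≤ n
  · refine hB b (by omega) (sub_mem (sub_mem ?_ ?_) (Submodule.smul_mem _ _ hy))
    · exact raiseNonneg_mem hfF hgF n hb (hfF _ _ (by rw [hb]; ring) _ hy)
    · refine hfF (b + 2) _ (by ring) _ (raiseNonneg_mem hfF hgF _ ?_ (?_ : y ∈ F ((n + 2 : ℕ) : ℤ)))
      · rw [hb]; push_cast; ring
      · convert hy using 2; rw [hb]; push_cast; ring
  · have hb' : b = ((n + 2 : ℕ) : ℤ) := by rw [hb]; push_cast; ring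
    rw [hb'] at hy ⊢
    have h1 := hgf _ _ hy
    have h2 := add_mem (hfZ _ ((n + 2 : ℕ) : ℤ) (by ring) _
      (raiseNonneg_mem (B := B) hfZ hgZ _ rfl h1)) (Submodule.smul_mem _ ((n : K) + 2) h1)
    convert h2 using 1
    rw [raiseNonneg, if_neg h]
    simp only [Module.End.mul_apply, LinearMap.add_apply, LinearMap.smul_apply,
      Module.End.one_apply, map_sub, pow_succ f (n + 1)]
    module

lemma raiseNonneg_primitive
    (hfZ : ShiftsDegree f Z (-2)) (hgZ : ∀ m : ℕ, ∀ x ∈ Z (-m), g m x ∈ Z m)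
    (n : ℕ) {p : V} (hp : (f ^ (n + 1)) p ∈ Z (-(n + 2 : ℕ))) :
    raiseNonneg f g B n p ∈ Z (n + 2) := by
  rw [raiseNonneg]
  split_ifs with h
  · simp
  · have h1 := hgZ _ _ hp
    refine add_mem (hfZ _ _ (by push_cast; ring) _ (raiseNonneg_mem hfZ hgZ _ rfl h1))
      (Submodule.smul_mem _ _ ?_)
    exact_mod_cast h1

lemma raiseDegree_neg
    (hfZ : ShiftsDegree f Z (-2)) (hgZ : ∀ m : ℕ, ∀ x ∈ Z (-m), g m x ∈ Z m)
    (hgf : ∀ m : ℕ, ∀ y ∈ F m, g m ((f ^ m) y) - y ∈ Z m)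
    (m : ℕ) {b : ℤ} (hb : b = -m + 2) {y : V} (hy : y ∈ F m) :
    raiseDegree f g B (-m) ((f ^ m) y) - (f ^ m) (raiseNonneg f g B m y)
      - (m : K) • (f ^ (m - 1)) y ∈ Z b := by
  match m, hy with
  | 0, hy =>
    have : raiseDegree f g B (-(0 : ℕ)) = raiseNonneg f g B 0 := rfl
    rw [this]
    simp
  | m + 1, hy =>
    have : raiseDegree f g B (-((m + 1 : ℕ) : ℤ)) =
      (f ^ (m + 1) * raiseNonneg f g B (m + 1) + ((m : K) + 1) • f ^ m) * g (m + 1) := rfl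
    rw [this]
    have h1 := hgf _ _ hy
    have h2 := add_mem
      (hfZ.pow_apply (m + 1) (b := b) (by rw [hb]; push_cast; ring)
        (raiseNonneg_mem (B := B) hfZ hgZ _ rfl h1))
      (Submodule.smul_mem _ ((m : K) + 1)
        (hfZ.pow_apply m (b := b) (by rw [hb]; push_cast; ring) h1))
    convert h2 using 1
    simp only [Module.End.mul_apply, LinearMap.add_apply, LinearMap.smul_apply, map_sub,
      Nat.add_sub_cancel]
    push_cast
    module

lemma raiseDegree_commutator
    (hfF : ShiftsDegree f F (-2)) (hfZ : ShiftsDegree f Z (-2))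
    (hB : ∀ n : ℤ, (B : ℤ) ≤ n → F n ≤ Z n) (hgF : ∀ m : ℕ, ∀ x ∈ F (-m), g m x ∈ F m)
    (hgZ : ∀ m : ℕ, ∀ x ∈ Z (-m), g m x ∈ Z m)
    (hfg : ∀ m : ℕ, ∀ x ∈ F (-m), x - (f ^ m) (g m x) ∈ Z (-m))
    (hgf : ∀ m : ℕ, ∀ y ∈ F m, g m ((f ^ m) y) - y ∈ Z m)
    (n : ℤ) {x : V} (hx : x ∈ F n) :
    raiseDegree f g B (n - 2) (f x) - f (raiseDegree f g B n x) - (n : K) • x ∈ Z n := by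
  obtain ⟨m, rfl⟩ | rfl | ⟨m, rfl⟩ :
      (∃ m : ℕ, n = m + 2) ∨ n = 1 ∨ ∃ m : ℕ, n = -m := by
    rcases le_or_gt n 0 with h | h
    · exact .inr (.inr ⟨n.natAbs, by omega⟩)
    · by_cases h1 : n = 1
      · exact .inr (.inl h1)
      · exact .inl ⟨(n - 2).natAbs, by omega⟩
  · have h := raiseNonneg_commutator hfF hfZ hB hgF hgZ hgf m rfl hx
    rw [add_sub_cancel_right]
    push_cast
    exact h
  · have h := raiseDegree_neg (B := B) hfZ hgZ hgf 1 (b := 1) (by norm_num) (by exact_mod_cast hx)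
    simpa [show raiseDegree f g B 1 = raiseNonneg f g B 1 from rfl] using h
  · set R := raiseNonneg f g B
    set e := raiseDegree f g B
    have heZ : ∀ n : ℤ, ∀ x ∈ Z n, e n x ∈ Z (n + 2) := fun n x hx => raiseDegree_mem hfZ hgZ n hx
    obtain ⟨y, hy, hxy⟩ : ∃ y ∈ F m, x - (f ^ m) y ∈ Z (-m) := ⟨_, hgF m x hx, hfg m x hx⟩
    obtain ⟨z, hz, hyz⟩ : ∃ z ∈ F ((m + 2 : ℕ) : ℤ),
        (f ^ (m + 1)) y - (f ^ (m + 2)) z ∈ Z (-(m + 2 : ℕ)) := by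
      have := hfF.pow_apply (m + 1) (b := -(m + 2 : ℕ)) (by push_cast; ring) hy
      exact ⟨_, hgF _ _ this, hfg _ _ this⟩
    have hfx : f (x - (f ^ m) y) ∈ Z (-(m + 2 : ℕ)) := hfZ _ _ (by push_cast; ring) _ hxy
    have c1 : e (-(m + 2 : ℕ)) (f (x - (f ^ m) y)) ∈ Z (-m) := by
      convert heZ _ _ hfx using 2; push_cast; ring
    have c2 : f (e (-m) (x - (f ^ m) y)) ∈ Z (-m) := hfZ _ _ (by ring) _ (heZ _ _ hxy)
    have c3 := Submodule.smul_mem _ (m : K) hxy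
    have c4 : e (-(m + 2 : ℕ)) ((f ^ (m + 1)) y - (f ^ (m + 2)) z) ∈ Z (-m) := by
      convert heZ _ _ hyz using 2; push_cast; ring
    have c5 := raiseDegree_neg (B := B) hfZ hgZ hgf (m + 2) (b := -m) (by push_cast; ring) hz
    have c6 := hfZ _ (-m) (by ring) _ (raiseDegree_neg (B := B) hfZ hgZ hgf m rfl hy)
    have c7 : (f ^ (m + 1)) (R m (y - f z)) ∈ Z (-m) := by
      refine hfZ.pow_apply (m + 1) (by push_cast; ring)
        (raiseNonneg_primitive (B := B) hfZ hgZ m (p := y - f z) ?_)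
      rw [map_sub, ← Module.End.mul_apply (f ^ (m + 1)), ← pow_succ]
      exact hyz
    have c8 := hfZ.pow_apply (m + 1) (b := -m) (by push_cast; ring)
      (raiseNonneg_commutator hfF hfZ hB hgF hgZ hgf m rfl (by exact_mod_cast hz))
    have c9 : (m : K) • f ((f ^ (m - 1)) y) = (m : K) • (f ^ m) y := by
      cases m with
      | zero => simp
      | succ m => simp [pow_succ' f]
    have hn : (-m - 2 : ℤ) = -(m + 2 : ℕ) := by push_cast; ring
    rw [hn]
    have total := add_mem (sub_mem (sub_mem (sub_mem (add_mem c1 (add_mem c4 c5)) c2) c6)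
      (add_mem c7 c8)) c3
    convert total using 1
    have hp1 (v : V) : (f ^ (m + 1)) v = f ((f ^ m) v) := by rw [pow_succ', Module.End.mul_apply]
    have hp1' (v : V) : (f ^ m) (f v) = f ((f ^ m) v) := by
      rw [← hp1, pow_succ, Module.End.mul_apply]
    have hp2 (v : V) : (f ^ (m + 2)) v = f (f ((f ^ m) v)) := by
      rw [pow_succ', Module.End.mul_apply, hp1]
    simp only [map_sub, map_smul, hp1, hp1', hp2, c9,
      show m + 2 - 1 = m + 1 from rfl]
    push_cast
    module

end Raise

/-- Existence of a raising operator on a family of subquotients satisfying hard Lefschetz. -/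
lemma exists_raising_family {f : Module.End K V} {F Z : ℤ → Submodule K V}
    (hZF : ∀ n, Z n ≤ F n) (hfF : ShiftsDegree f F (-2)) (hfZ : ShiftsDegree f Z (-2))
    {B : ℕ} (hB : ∀ n : ℤ, (B : ℤ) ≤ n → F n ≤ Z n)
    (hsurj : ∀ m : ℕ, ∀ x ∈ F (-m), ∃ y ∈ F m, x - (f ^ m) y ∈ Z (-m))
    (hinj : ∀ m : ℕ, ∀ y ∈ F m, (f ^ m) y ∈ Z (-m) → y ∈ Z m) :
    ∃ e : ℤ → Module.End K V, (∀ n, ∀ x ∈ F n, e n x ∈ F (n + 2)) ∧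
      (∀ n, ∀ x ∈ Z n, e n x ∈ Z (n + 2)) ∧
      ∀ n, ∀ x ∈ F n, e (n - 2) (f x) - f (e n x) - (n : K) • x ∈ Z n := by
  choose g hg using fun m : ℕ => exists_linear_choice _ _ _ _ (hsurj m)
  have hgF : ∀ m : ℕ, ∀ x ∈ F (-m), g m x ∈ F m := fun m x hx => (hg m x hx).1
  have hfg : ∀ m : ℕ, ∀ x ∈ F (-m), x - (f ^ m) (g m x) ∈ Z (-m) := fun m x hx => (hg m x hx).2
  have hgZ : ∀ m : ℕ, ∀ x ∈ Z (-m), g m x ∈ Z m := fun m x hx =>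
    hinj m _ (hgF m x (hZF _ hx)) ((Submodule.sub_mem_iff_right _ hx).1 (hfg m x (hZF _ hx)))
  have hgf : ∀ m : ℕ, ∀ y ∈ F m, g m ((f ^ m) y) - y ∈ Z m := fun m y hy => by
    have hy' := hfF.pow_apply m (b := -m) (by ring) hy
    refine hinj m _ (sub_mem (hgF m _ hy') hy) ?_
    rw [map_sub, ← neg_sub]
    exact neg_mem (hfg m _ hy')
  exact ⟨raiseDegree f g B, fun n x hx => raiseDegree_mem hfF hgF n hx,
    fun n x hx => raiseDegree_mem hfZ hgZ n hx,
    fun n x hx => raiseDegree_commutator hfF hfZ hB hgF hgZ hfg hgf n hx⟩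

end Lefschetz

section AdaptedBasis

open Submodule

variable {K V : Type*} [Field K] [AddCommGroup V] [Module K V]

lemma exists_adapted_insert [FiniteDimensional K V] {M : ℤ → Submodule K V} (hM : Monotone M)
    {S : Set V} (hS : ∀ k, M k ⊓ span K S ≤ span K (S ∩ M k)) (x : V) :
    ∃ x', x' - x ∈ span K S ∧
      ∀ k, M k ⊓ span K (insert x' S) ≤ span K (insert x' S ∩ M k) := by
  obtain ⟨x', hx', hmin⟩ : ∃ x', x' - x ∈ span K S ∧
      ∀ k, ∀ y ∈ M k, y - x ∈ span K S → x' ∈ M k := by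
    by_cases h : ∃ k, ∃ y ∈ M k, y - x ∈ span K S
    · obtain ⟨_, ⟨k, ⟨y, hy, hyx⟩, rfl⟩, hk⟩ := IsArtinian.set_has_minimal
        (M '' {k | ∃ y ∈ M k, y - x ∈ span K S}) (by obtain ⟨k, hk⟩ := h; exact ⟨_, k, hk, rfl⟩)
      refine ⟨y, hyx, fun k' z hz hzx => ?_⟩
      rcases le_total k k' with hkk | hkk
      · exact hM hkk hy
      · rw [((hM hkk).eq_or_lt.resolve_right (hk _ ⟨k', ⟨z, hz, hzx⟩, rfl⟩))]
        exact hy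
    · push Not at h
      exact ⟨x, by simp, fun k y hy hyx => absurd hyx (h k y hy)⟩
  refine ⟨x', hx', fun k v hv => ?_⟩
  obtain ⟨hvM, hvS⟩ := hv
  obtain ⟨a, s, hs, rfl⟩ := mem_span_insert.1 hvS
  have hmono : span K (S ∩ M k) ≤ span K (insert x' S ∩ M k) :=
    span_mono (Set.inter_subset_inter_left _ (Set.subset_insert _ _))
  by_cases ha : a = 0
  · subst ha
    rw [zero_smul, zero_add] at hvM ⊢
    exact hmono (hS k ⟨hvM, hs⟩)
  · have hx'M : x' ∈ M k := by
      refine hmin k (a⁻¹ • (a • x' + s)) (smul_mem _ _ hvM) ?_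
      rw [smul_add, inv_smul_smul₀ ha, add_sub_right_comm]
      exact add_mem hx' (smul_mem _ _ hs)
    refine add_mem (smul_mem _ _ (subset_span ⟨Set.mem_insert _ _, hx'M⟩)) (hmono (hS k ⟨?_, hs⟩))
    exact (Submodule.add_mem_iff_right _ (smul_mem _ a hx'M)).1 hvM

lemma exists_adapted_extension [FiniteDimensional K V] {M : ℤ → Submodule K V} (hM : Monotone M)
    {S : Set V} (hli : LinearIndepOn K id S) (hS : ∀ k, M k ⊓ span K S ≤ span K (S ∩ M k))
    (U : Submodule K V) (hU : span K S ≤ U) :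
    ∃ S', S ⊆ S' ∧ LinearIndepOn K id S' ∧ span K S' = U ∧
      ∀ k, M k ⊓ span K S' ≤ span K (S' ∩ M k) := by
  induction h : Module.finrank K U - Module.finrank K (span K S)
    using Nat.strong_induction_on generalizing S with
  | _ c ih =>
  rcases hU.eq_or_lt with heq | hlt
  · exact ⟨S, subset_rfl, hli, heq, hS⟩
  obtain ⟨x, hxU, hxS⟩ := SetLike.exists_of_lt hlt
  obtain ⟨x', hx', hadapt⟩ := exists_adapted_insert hM hS x
  have hx'S : x' ∉ span K S := fun h' => hxS ((Submodule.sub_mem_iff_right _ h').1 hx')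
  have hx'U : x' ∈ U := (Submodule.sub_mem_iff_left _ hxU).1 (hU hx')
  have hlt' : span K S < span K (insert x' S) :=
    lt_of_le_of_ne (span_mono (Set.subset_insert _ _))
      fun h' => hx'S (h' ▸ subset_span (Set.mem_insert _ _))
  have hle' : span K (insert x' S) ≤ U :=
    span_le.2 (Set.insert_subset hx'U (span_le.1 hU))
  have hlt'' := finrank_lt_finrank_of_lt hlt'
  have hle'' := finrank_mono hle'
  obtain ⟨S', hSS', hli', hspan, hS'⟩ := ih _ (by omega)
    (hli.id_insert hx'S) hadapt hle' rfl
  exact ⟨S', (Set.subset_insert _ _).trans hSS', hli', hspan, hS'⟩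

/-- A basis is adapted to a filtration if each step is spanned by the basis vectors it contains. -/
def Module.Basis.IsAdapted {ι : Type*} (b : Module.Basis ι K V) (M : ℤ → Submodule K V) : Prop :=
  ∀ k, M k ≤ span K (b '' {i | b i ∈ M k})

/-- Two filtrations of a finite-dimensional vector space have a common adapted basis. -/
lemma exists_basis_isAdapted [FiniteDimensional K V] {M W : ℤ → Submodule K V} (hM : Monotone M)
    (hW : IsFiniteFiltration W) :
    ∃ (ι : Set V) (b : Module.Basis ι K V), b.IsAdapted M ∧ b.IsAdapted W := by
  obtain ⟨hmono, ⟨a, ha⟩, ⟨c, hc⟩⟩ := hW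
  have key : ∀ w, a ≤ w → ∃ S : Set V, LinearIndepOn K id S ∧ span K S = W w ∧
      (∀ k, M k ⊓ span K S ≤ span K (S ∩ M k)) ∧ ∀ w' ≤ w, W w' ≤ span K (S ∩ W w') := by
    intro w hw
    induction w, hw using Int.leInduction with
    | base =>
      refine ⟨∅, linearIndepOn_empty _ _, by simp [ha], by simp, fun w' hw' => by simp [ha w' hw']⟩
    | succ w hw ih =>
      obtain ⟨S, hli, hspan, hSM, hSW⟩ := ih
      obtain ⟨S', hSS', hli', hspan', hSM'⟩ := exists_adapted_extension hM hli hSM (W (w + 1))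
        (hspan.trans_le (hmono (by omega)))
      refine ⟨S', hli', hspan', hSM', fun w' hw' => ?_⟩
      rcases hw'.eq_or_lt with rfl | hlt
      · rw [← hspan']
        exact span_mono fun x hx => ⟨hx, subset_span hx⟩
      · exact (hSW w' (by omega)).trans (span_mono (Set.inter_subset_inter_left _ hSS'))
  obtain ⟨S, hli, hspan, hSM, hSW⟩ := key (max a c) (le_max_left _ _)
  rw [hc _ (le_max_right _ _)] at hspan
  let b : Module.Basis S K V := Module.Basis.mk hli (by simpa using hspan.ge)
  have hb (i : S) : b i = i := by simp [b]
  have himage (U : Submodule K V) : b '' {i | b i ∈ U} = S ∩ U := by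
    ext v
    simp [hb, and_comm]
  refine ⟨S, b, fun k => ?_, fun w => ?_⟩
  · rw [himage]
    simpa [hspan] using hSM k
  · rw [himage]
    rcases le_total w (max a c) with h | h
    · exact hSW w h
    · rw [hc w ((le_max_right _ _).trans h)]
      simp [hspan]

lemma Module.Basis.span_image_inf_le {ι : Type*} (b : Module.Basis ι K V) (s t : Set ι) :
    span K (b '' s) ⊓ span K (b '' t) ≤ span K (b '' (s ∩ t)) := by
  intro x hx
  rw [mem_inf, b.mem_span_image, b.mem_span_image] at hx
  exact b.mem_span_image.2 (Set.subset_inter hx.1 hx.2)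

lemma exists_stable_above [FiniteDimensional K V] {M : ℤ → Submodule K V} (hM : Monotone M) :
    ∃ B : ℕ, ∀ k : ℤ, (B : ℤ) < k → M k ≤ M (k - 1) := by
  obtain ⟨B, hB⟩ := monotone_stabilizes_iff_noetherian.2 (inferInstanceAs (IsNoetherian K V))
    ⟨fun n : ℕ => M n, fun a b h => hM (by exact_mod_cast h)⟩
  refine ⟨B, fun k hk => ?_⟩
  have h : M B = M (k.toNat : ℤ) := hB k.toNat (by omega)
  rw [Int.toNat_of_nonneg (show 0 ≤ k by omega)] at h
  rw [← h]
  exact hM (by omega)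

lemma exists_stable_below [FiniteDimensional K V] {M : ℤ → Submodule K V} (hM : Monotone M) :
    ∃ B : ℕ, ∀ k : ℤ, k ≤ -(B : ℤ) → M k ≤ M (k - 1) := by
  obtain ⟨B, hB⟩ := IsArtinian.monotone_stabilizes (R := K) (M := V)
    ⟨fun n : ℕ => OrderDual.toDual (M (-n)), fun a b h => hM (by omega)⟩
  refine ⟨B, fun k hk => ?_⟩
  have h : M (-B) = M (-((1 - k).toNat : ℤ)) := hB (1 - k).toNat (by omega)
  rw [Int.toNat_of_nonneg (show 0 ≤ 1 - k by omega), neg_sub] at h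
  rw [← h]
  exact hM hk

end AdaptedBasis

section Raising

variable {K V : Type*} [Field K] [AddCommGroup V] [Module K V]

/-- `E` completes `N` to an `sl₂`-action on the bigraded pieces `gr^M_k gr^W_w`, with
`gr^M_k gr^W_w` of weight `k - w`. -/
structure IsRaisingOperator (N E : Module.End K V) (W M : ℤ → Submodule K V) : Prop where
  shiftsM : ShiftsDegree E M 2
  shiftsW : ShiftsDegree E W 0
  commutator : ∀ k w : ℤ, ∀ x ∈ M k ⊓ W w,
    E (N x) - N (E x) - ((k : K) - w) • x ∈ M (k - 1) ⊔ W (w - 1)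

lemma ShiftsDegree.sup_mem {T : Module.End K V} {M W : ℤ → Submodule K V} {d : ℤ}
    (hM : ShiftsDegree T M d) (hW : ShiftsDegree T W 0) {k k' w : ℤ} (hk : k' = k + d)
    {x : V} (hx : x ∈ M k ⊔ W w) : T x ∈ M k' ⊔ W w := by
  obtain ⟨y, hy, z, hz, rfl⟩ := Submodule.mem_sup.1 hx
  rw [map_add]
  exact Submodule.add_mem_sup (hM _ _ hk _ hy) (hW _ _ (add_zero _).symm _ hz)

/-- The part of `M_{w+n}` in `W_w`. -/
def grNum (W M : ℤ → Submodule K V) (w n : ℤ) : Submodule K V := M (w + n) ⊓ W w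

/-- The kernel of the projection of `grNum W M w n` onto `gr^M_{w+n} gr^W_w`. -/
def grDen (W M : ℤ → Submodule K V) (w n : ℤ) : Submodule K V :=
  M (w + n) ⊓ W w ⊓ (M (w + n - 1) ⊔ W (w - 1))

lemma ShiftsDegree.grNum {T : Module.End K V} {M W : ℤ → Submodule K V} {d : ℤ}
    (hM : ShiftsDegree T M d) (hW : ShiftsDegree T W 0) (w : ℤ) :
    ShiftsDegree T (grNum W M w) d := fun a b hb x hx =>
  ⟨hM _ _ (by rw [hb]; ring) _ hx.1, hW _ _ (add_zero _).symm _ hx.2⟩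

lemma ShiftsDegree.grDen {T : Module.End K V} {M W : ℤ → Submodule K V} {d : ℤ}
    (hM : ShiftsDegree T M d) (hW : ShiftsDegree T W 0) (w : ℤ) :
    ShiftsDegree T (grDen W M w) d := fun a b hb _ hx =>
  ⟨hM.grNum hW w a b hb _ hx.1, hM.sup_mem hW (by rw [hb]; ring) hx.2⟩

lemma grNum_le_grDen {W M : ℤ → Submodule K V} {w n : ℤ} (h : M (w + n) ≤ M (w + n - 1)) :
    grNum W M w n ≤ grDen W M w n := fun _ hx => ⟨hx, Submodule.mem_sup_left (h hx.1)⟩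

lemma exists_bound_grNum_le [FiniteDimensional K V] {W M : ℤ → Submodule K V} (hM : Monotone M)
    (w : ℤ) : ∃ B : ℕ, ∀ n : ℤ, (B : ℤ) ≤ n →
      grNum W M w n ≤ grDen W M w n ∧ grNum W M w (-n) ≤ grDen W M w (-n) := by
  obtain ⟨B, hB⟩ := exists_stable_above hM
  obtain ⟨C, hC⟩ := exists_stable_below hM
  refine ⟨B + C + w.natAbs + 1, fun n hn => ⟨grNum_le_grDen (hB _ ?_), grNum_le_grDen (hC _ ?_)⟩⟩
  all_goals omega

lemma IsRelMonodromyFiltration.exists_raising_fixed_weight [FiniteDimensional K V]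
    {N : Module.End K V} {W M : ℤ → Submodule K V} (hM : IsRelMonodromyFiltration N W M)
    (hNW : ShiftsDegree N W 0) (w : ℤ) :
    ∃ e : ℤ → Module.End K V, (∀ k, ∀ x ∈ M k ⊓ W w, e k x ∈ M (k + 2) ⊓ W w) ∧
      (∀ k, ∀ x ∈ M k ⊓ W w, x ∈ M (k - 1) ⊔ W (w - 1) → e k x ∈ M (k + 1) ⊔ W (w - 1)) ∧
      ∀ k, ∀ x ∈ M k ⊓ W w,
        e (k - 2) (N x) - N (e k x) - ((k : K) - w) • x ∈ M (k - 1) ⊔ W (w - 1) := by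
  obtain ⟨hmono, hNM, hiso⟩ := hM
  have hNM' : ShiftsDegree N M (-2) := fun a b hb x hx => hb ▸ hNM a x hx
  obtain ⟨B, hB⟩ := exists_bound_grNum_le (W := W) hmono w
  obtain ⟨e, heF, heZ, hcomm⟩ := exists_raising_family (f := N) (F := grNum W M w)
    (Z := grDen W M w) (fun n => inf_le_left) (hNM'.grNum hNW w) (hNM'.grDen hNW w)
    (fun n hn => (hB n hn).1)
    (fun m x hx => by
      obtain ⟨y, hy, hxy⟩ := (hiso w m).1 x hx
      exact ⟨y, hy, sub_mem hx ((hNM'.grNum hNW w).pow_apply m (by ring) hy), hxy⟩)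
    (fun m y hy hfy => ⟨hy, (hiso w m).2 y hy hfy.2⟩)
  refine ⟨fun k => e (k - w), fun k x hx => ?_, fun k x hx hx' => ?_, fun k x hx => ?_⟩
  · have h := heF (k - w) x (by simpa [grNum] using hx)
    simpa [grNum, ← add_assoc] using h
  · have h := (heZ (k - w) x ⟨by simpa using hx, by simpa using hx'⟩).2
    rw [show w + (k - w + 2) - 1 = k + 1 by ring] at h
    exact h
  · have h := (hcomm (k - w) x (by simpa [grNum] using hx)).2
    rw [add_sub_cancel, sub_right_comm k w 2, Int.cast_sub] at h
    exact h

/-- A Jacobson–Morozov type statement: a relative monodromy filtration admits a raising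
operator. -/
lemma IsRelMonodromyFiltration.exists_isRaisingOperator [FiniteDimensional K V]
    {N : Module.End K V} {W M : ℤ → Submodule K V} (hM : IsRelMonodromyFiltration N W M)
    (hW : IsFiniteFiltration W) (hNW : ShiftsDegree N W 0) :
    ∃ E, IsRaisingOperator N E W M := by
  classical
  have hmono := hM.1
  have hWmono := hW.1
  choose e heF heZ hcomm using fun w => hM.exists_raising_fixed_weight hNW w
  obtain ⟨ι, b, hbM, hbW⟩ := exists_basis_isAdapted hmono hW
  let IsDegree (i : ι) (p : ℤ × ℤ) : Prop :=
    b i ∈ M p.1 ⊓ W p.2 ∧ b i ∉ M (p.1 - 1) ∧ b i ∉ W (p.2 - 1)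
  let E : Module.End K V := b.constr K fun i =>
    if h : ∃ p, IsDegree i p then e h.choose.2 h.choose.1 (b i) else 0
  have huniq {i p k w} (h : IsDegree i p) (hk : b i ∈ M k) (hw : b i ∈ W w) :
      p.1 ≤ k ∧ p.2 ≤ w := by
    constructor <;> by_contra! hlt
    · exact h.2.1 (hmono (by omega) hk)
    · exact h.2.2 (hWmono (by omega) hw)
  have hE_eq {i k w} (h : IsDegree i (k, w)) : E (b i) = e w k (b i) := by
    have hex : ∃ p, IsDegree i p := ⟨_, h⟩
    have hs := hex.choose_spec
    have h1 := huniq h hs.1.1 hs.1.2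
    have h2 := huniq hs h.1.1 h.1.2
    have hp : hex.choose = (k, w) := Prod.ext (le_antisymm h2.1 h1.1) (le_antisymm h2.2 h1.2)
    simp only [E, b.constr_basis, dif_pos hex, hp]
  have hE_zero {i} (h : ¬ ∃ p, IsDegree i p) : E (b i) = 0 := by
    simp only [E, b.constr_basis, dif_neg h]
  have hEM : ShiftsDegree E M 2 := by
    rintro k _ rfl x hx
    refine (hbM k).trans (Submodule.span_le.2 ?_ : _ ≤ (M (k + 2)).comap E) hx
    rintro _ ⟨i, hi, rfl⟩
    by_cases h : ∃ p, IsDegree i p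
    · obtain ⟨⟨k', w'⟩, h⟩ := h
      have := (huniq h hi h.1.2).1
      rw [SetLike.mem_coe, Submodule.mem_comap, hE_eq h]
      exact hmono (by omega) (heF w' k' _ h.1).1
    · simp [hE_zero h]
  have hEW : ShiftsDegree E W 0 := by
    rintro w _ rfl x hx
    rw [add_zero]
    refine (hbW w).trans (Submodule.span_le.2 ?_ : _ ≤ (W w).comap E) hx
    rintro _ ⟨i, hi, rfl⟩
    by_cases h : ∃ p, IsDegree i p
    · obtain ⟨⟨k', w'⟩, h⟩ := h
      have := (huniq h h.1.1 hi).2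
      rw [SetLike.mem_coe, Submodule.mem_comap, hE_eq h]
      exact hWmono this (heF w' k' _ h.1).2
    · simp [hE_zero h]
  have hEe (k w : ℤ) (x) (hx : x ∈ M k ⊓ W w) : E x - e w k x ∈ M (k + 1) ⊔ W (w - 1) := by
    have hx' := b.span_image_inf_le _ _ ⟨hbM k hx.1, hbW w hx.2⟩
    refine (Submodule.span_le.2 ?_ : _ ≤ (M (k + 1) ⊔ W (w - 1)).comap (E - e w k)) hx'
    rintro _ ⟨i, ⟨hiM, hiW⟩, rfl⟩
    rw [SetLike.mem_coe, Submodule.mem_comap, LinearMap.sub_apply]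
    by_cases h : b i ∈ M (k - 1) ∨ b i ∈ W (w - 1)
    · refine sub_mem ?_ (heZ w k _ ⟨hiM, hiW⟩
        (h.elim (fun h => Submodule.mem_sup_left h) fun h => Submodule.mem_sup_right h))
      rcases h with h | h
      · exact Submodule.mem_sup_left (hEM _ _ (by ring) _ h)
      · exact Submodule.mem_sup_right (hEW _ _ (by ring) _ h)
    · have h' : IsDegree i (k, w) := ⟨⟨hiM, hiW⟩, not_or.1 h⟩
      simp [hE_eq h']
  have hNM : ShiftsDegree N M (-2) := fun a b hb x hx => hb ▸ hM.2.1 a x hx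
  refine ⟨E, hEM, hEW, fun k w x hx => ?_⟩
  have h1 := hcomm w k x hx
  have h2 := hEe (k - 2) w (N x) ⟨hM.2.1 k x hx.1, hNW _ _ (add_zero _).symm _ hx.2⟩
  rw [show k - 2 + 1 = k - 1 by ring] at h2
  have h3 := hNM.sup_mem hNW (k' := k - 1) (by ring) (hEe k w x hx)
  convert add_mem (sub_mem h2 h3) h1 using 1
  rw [map_sub]
  abel

lemma exists_preimage_of_injective_modulo [FiniteDimensional K V] {A B B₀ : Submodule K V}
    {f g : Module.End K V} (hf : ∀ x ∈ A, f x ∈ B) (hg : ∀ x ∈ B, g x ∈ A)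
    (hfg : ∀ x ∈ B₀, f (g x) ∈ B₀) (hinj : ∀ x ∈ B, f (g x) ∈ B₀ → x ∈ B₀)
    {x : V} (hx : x ∈ B) : ∃ y ∈ A, x - f y ∈ B₀ := by
  let T : Module.End K B := (f * g).restrict fun x hx => hf _ (hg x hx)
  let T' := Submodule.mapQ (B₀.submoduleOf B) (B₀.submoduleOf B) T fun x hx => hfg x hx
  have hT' : Function.Injective T' := by
    rw [injective_iff_map_eq_zero]
    intro q
    obtain ⟨x, rfl⟩ := Submodule.mkQ_surjective _ q
    exact fun h => (Submodule.Quotient.mk_eq_zero _).2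
      (hinj x x.2 ((Submodule.Quotient.mk_eq_zero (B₀.submoduleOf B) (x := T x)).1 h))
  obtain ⟨q, hq⟩ := LinearMap.injective_iff_surjective.1 hT' (Submodule.Quotient.mk ⟨x, hx⟩)
  obtain ⟨z, rfl⟩ := Submodule.mkQ_surjective _ q
  exact ⟨g z, hg z z.2,
    (Submodule.Quotient.eq (B₀.submoduleOf B) (x := ⟨x, hx⟩) (y := T z)).1 hq.symm⟩

lemma IsRaisingOperator.isRelMonodromyFiltration [CharZero K] [FiniteDimensional K V]
    {N E : Module.End K V} {W M : ℤ → Submodule K V} (hE : IsRaisingOperator N E W M)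
    (hM : Monotone M) (hNM : ShiftsDegree N M (-2)) (hNW : ShiftsDegree N W 0) :
    IsRelMonodromyFiltration N W M := by
  refine ⟨hM, fun w x hx => hNM _ _ (by ring) x hx, fun w m => ?_⟩
  set F := grNum W M w with hF
  set Z := grDen W M w with hZ
  have hZF : ∀ n, Z n ≤ F n := fun n => inf_le_left
  have hNF := hNM.grNum hNW w
  have hNZ := hNM.grDen hNW w
  have hEF := hE.shiftsM.grNum hE.shiftsW w
  have hEZ := hE.shiftsM.grDen hE.shiftsW w
  rw [← hF] at hNF hEF
  rw [← hZ] at hNZ hEZ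
  obtain ⟨B, hB⟩ := exists_bound_grNum_le (W := W) hM w
  have hcomm : ∀ n : ℤ, ∀ x ∈ F n, E (N x) - N (E x) - (n : K) • x ∈ Z n := fun n x hx => by
    refine ⟨sub_mem (sub_mem ?_ ?_) (Submodule.smul_mem _ _ hx), ?_⟩
    · exact hEF _ _ (by ring) _ (hNF _ _ rfl _ hx)
    · exact hNF _ _ (by ring) _ (hEF _ _ rfl _ hx)
    · simpa using hE.commutator (w + n) w x hx
  have hinj : ∀ y ∈ F m, (N ^ m) y ∈ Z (-m) → y ∈ Z m := fun y hy hfy =>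
    mem_of_pow_mem_of_commutator hNF hNZ hEF hEZ hcomm (fun n hn => (hB n hn).1) m hy hfy
  have hinj' : ∀ y ∈ F (-m), (E ^ m) y ∈ Z m → y ∈ Z (-m) := fun y hy hfy => by
    refine mem_of_pow_mem_of_commutator (f := E) (e := N) (F := fun n => F (-n))
      (Z := fun n => Z (-n)) ?_ ?_ ?_ ?_ ?_ (fun n hn => (hB n hn).2) m hy (by simpa using hfy)
    · exact fun a b hb => hEF _ _ (by rw [hb]; ring)
    · exact fun a b hb => hEZ _ _ (by rw [hb]; ring)
    · exact fun a b hb => hNF _ _ (by rw [hb]; ring)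
    · exact fun a b hb => hNZ _ _ (by rw [hb]; ring)
    · intro n x hx
      convert neg_mem (hcomm (-n) x hx) using 1
      push_cast
      module
  have hNFm : ∀ x ∈ F m, (N ^ m) x ∈ F (-m) := fun x hx => hNF.pow_apply m (by ring) hx
  have hEFm : ∀ x ∈ F (-m), (E ^ m) x ∈ F m := fun x hx => hEF.pow_apply m (by ring) hx
  constructor
  · intro x hx
    obtain ⟨y, hy, hxy⟩ := exists_preimage_of_injective_modulo (B₀ := Z (-m)) hNFm hEFm
      (fun x hx => hNZ.pow_apply m (by ring) (hEZ.pow_apply m (b := m) (by ring) hx))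
      (fun x hx h => hinj' x hx (hinj _ (hEFm x hx) h)) (x := x) hx
    exact ⟨y, hy, hxy.2⟩
  · intro y hy h
    exact (hinj y hy ⟨hNFm y hy, h⟩).2

end Raising

section Tensor

variable {K V₁ V₂ : Type*} [Field K] [AddCommGroup V₁] [Module K V₁] [AddCommGroup V₂]
  [Module K V₂]

lemma tmul_mem_tensorFiltration {M₁ : ℤ → Submodule K V₁} {M₂ : ℤ → Submodule K V₂} {a c k : ℤ}
    (hk : k = a + c) {x : V₁} {y : V₂} (hx : x ∈ M₁ a) (hy : y ∈ M₂ c) :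
    x ⊗ₜ[K] y ∈ tensorFiltration K M₁ M₂ k := by
  refine Submodule.mem_iSup_of_mem a (Submodule.apply_mem_map₂ (TensorProduct.mk K V₁ V₂) hx ?_)
  rwa [hk, add_sub_cancel_left]

lemma tensorFiltration_le {M₁ : ℤ → Submodule K V₁} {M₂ : ℤ → Submodule K V₂} {k : ℤ}
    {P : Submodule K (V₁ ⊗[K] V₂)}
    (h : ∀ a c, k = a + c → ∀ x ∈ M₁ a, ∀ y ∈ M₂ c, x ⊗ₜ[K] y ∈ P) :
    tensorFiltration K M₁ M₂ k ≤ P :=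
  iSup_le fun a => Submodule.map₂_le.2 fun x hx y hy => h a (k - a) (by ring) x hx y hy

lemma tensorFiltration_mono {M₁ : ℤ → Submodule K V₁} {M₂ : ℤ → Submodule K V₂}
    (hM₂ : Monotone M₂) : Monotone (tensorFiltration K M₁ M₂) := fun k k' hk =>
  tensorFiltration_le fun a c hac _ hx _ hy =>
    tmul_mem_tensorFiltration (a := a) (c := k' - a) (by ring) hx (hM₂ (by omega) hy)

/-- The action of a pair of endomorphisms on the tensor product by the Leibniz rule. -/
noncomputable abbrev tensorDerivation (T₁ : Module.End K V₁) (T₂ : Module.End K V₂) :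
    Module.End K (V₁ ⊗[K] V₂) :=
  TensorProduct.map T₁ LinearMap.id + TensorProduct.map LinearMap.id T₂

lemma ShiftsDegree.tensorDerivation {M₁ : ℤ → Submodule K V₁} {M₂ : ℤ → Submodule K V₂}
    {T₁ : Module.End K V₁} {T₂ : Module.End K V₂} {d : ℤ}
    (h₁ : ShiftsDegree T₁ M₁ d) (h₂ : ShiftsDegree T₂ M₂ d) :
    ShiftsDegree (tensorDerivation T₁ T₂) (tensorFiltration K M₁ M₂) d := by
  intro k k' hk x hx
  refine tensorFiltration_le (P := (tensorFiltration K M₁ M₂ k').comap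
    (_root_.tensorDerivation T₁ T₂)) (fun a c hac x hx y hy => ?_) hx
  exact add_mem
    (tmul_mem_tensorFiltration (by rw [hk, hac]; ring) (h₁ a (a + d) rfl x hx) hy)
    (tmul_mem_tensorFiltration (by rw [hk, hac]; ring) hx (h₂ c (c + d) rfl y hy))

lemma tensorFiltration_le_span_basis {ι₁ ι₂ : Type*} {b₁ : Module.Basis ι₁ K V₁}
    {b₂ : Module.Basis ι₂ K V₂} {M₁ : ℤ → Submodule K V₁} {M₂ : ℤ → Submodule K V₂}
    (h₁ : b₁.IsAdapted M₁) (h₂ : b₂.IsAdapted M₂) (k : ℤ) :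
    tensorFiltration K M₁ M₂ k ≤ Submodule.span K (b₁.tensorProduct b₂ ''
      {p | ∃ a c, k = a + c ∧ b₁ p.1 ∈ M₁ a ∧ b₂ p.2 ∈ M₂ c}) := by
  refine iSup_le fun a => (Submodule.map₂_le_map₂ (h₁ a) (h₂ (k - a))).trans ?_
  rw [Submodule.map₂_span_span]
  refine Submodule.span_mono ?_
  rintro _ ⟨_, ⟨i, hi, rfl⟩, _, ⟨j, hj, rfl⟩, rfl⟩
  exact ⟨(i, j), ⟨a, k - a, by ring, hi, hj⟩, by simp⟩

lemma IsRaisingOperator.tensor [FiniteDimensional K V₁] [FiniteDimensional K V₂]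
    {W₁ M₁ : ℤ → Submodule K V₁} {W₂ M₂ : ℤ → Submodule K V₂}
    {N₁ E₁ : Module.End K V₁} {N₂ E₂ : Module.End K V₂}
    (hW₁ : IsFiniteFiltration W₁) (hW₂ : IsFiniteFiltration W₂)
    (hM₁ : Monotone M₁) (hM₂ : Monotone M₂)
    (hE₁ : IsRaisingOperator N₁ E₁ W₁ M₁) (hE₂ : IsRaisingOperator N₂ E₂ W₂ M₂) :
    IsRaisingOperator (tensorDerivation N₁ N₂) (tensorDerivation E₁ E₂)
      (tensorFiltration K W₁ W₂) (tensorFiltration K M₁ M₂) := by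
  refine ⟨hE₁.shiftsM.tensorDerivation hE₂.shiftsM, hE₁.shiftsW.tensorDerivation hE₂.shiftsW,
    fun k w x hx => ?_⟩
  obtain ⟨ι₁, b₁, hb₁M, hb₁W⟩ := exists_basis_isAdapted hM₁ hW₁
  obtain ⟨ι₂, b₂, hb₂M, hb₂W⟩ := exists_basis_isAdapted hM₂ hW₂
  set P := tensorFiltration K M₁ M₂ (k - 1) ⊔ tensorFiltration K W₁ W₂ (w - 1)
  have hx' := (b₁.tensorProduct b₂).span_image_inf_le _ _
    ⟨tensorFiltration_le_span_basis hb₁M hb₂M k hx.1,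
      tensorFiltration_le_span_basis hb₁W hb₂W w hx.2⟩
  refine (Submodule.span_le.2 ?_ : _ ≤ P.comap
    (tensorDerivation E₁ E₂ * tensorDerivation N₁ N₂ - tensorDerivation N₁ N₂ *
      tensorDerivation E₁ E₂ - ((k : K) - w) • 1)) hx'
  rintro _ ⟨⟨i, j⟩, ⟨⟨a, c, rfl, hiM, hjM⟩, ⟨a', c', rfl, hiW, hjW⟩⟩, rfl⟩
  have h₁ : (E₁ (N₁ (b₁ i)) - N₁ (E₁ (b₁ i)) - ((a : K) - a') • b₁ i) ⊗ₜ[K] b₂ j ∈ P := by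
    obtain ⟨y, hy, z, hz, hyz⟩ := Submodule.mem_sup.1 (hE₁.commutator a a' _ ⟨hiM, hiW⟩)
    rw [← hyz, TensorProduct.add_tmul]
    exact Submodule.add_mem_sup (tmul_mem_tensorFiltration (by ring) hy hjM)
      (tmul_mem_tensorFiltration (by ring) hz hjW)
  have h₂ : b₁ i ⊗ₜ[K] (E₂ (N₂ (b₂ j)) - N₂ (E₂ (b₂ j)) - ((c : K) - c') • b₂ j) ∈ P := by
    obtain ⟨y, hy, z, hz, hyz⟩ := Submodule.mem_sup.1 (hE₂.commutator c c' _ ⟨hjM, hjW⟩)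
    rw [← hyz, TensorProduct.tmul_add]
    exact Submodule.add_mem_sup (tmul_mem_tensorFiltration (by ring) hiM hy)
      (tmul_mem_tensorFiltration (by ring) hiW hz)
  have h := add_mem h₁ h₂
  simp only [TensorProduct.sub_tmul, TensorProduct.tmul_sub, ← TensorProduct.smul_tmul',
    TensorProduct.tmul_smul] at h
  simp only [SetLike.mem_coe, Submodule.mem_comap, LinearMap.sub_apply,
    Module.End.mul_apply, LinearMap.add_apply, LinearMap.smul_apply, Module.End.one_apply,
    Module.Basis.tensorProduct_apply, TensorProduct.map_tmul, map_add, LinearMap.id_apply]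
  convert h using 1
  push_cast
  module

end Tensor

/-- over a field of characteristic zero, the tensor product of relative monodromy
filtrations is a relative monodromy filtration of `N₁ ⊗ id + id ⊗ N₂` with respect to the
tensor product filtration. -/
theorem tensor_relative_monodromy_filtration
    {K V₁ V₂ : Type*} [Field K] [CharZero K]
    [AddCommGroup V₁] [Module K V₁] [FiniteDimensional K V₁]
    [AddCommGroup V₂] [Module K V₂] [FiniteDimensional K V₂]
    (W₁ M₁ : ℤ → Submodule K V₁) (W₂ M₂ : ℤ → Submodule K V₂)
    (N₁ : Module.End K V₁) (N₂ : Module.End K V₂)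
    (hW₁ : IsFiniteFiltration W₁) (hW₂ : IsFiniteFiltration W₂)
    (hN₁nil : IsNilpotent N₁) (hN₂nil : IsNilpotent N₂)
    (hN₁W : ∀ w : ℤ, ∀ x ∈ W₁ w, N₁ x ∈ W₁ w)
    (hN₂W : ∀ w : ℤ, ∀ x ∈ W₂ w, N₂ x ∈ W₂ w)
    (hM₁ : IsRelMonodromyFiltration N₁ W₁ M₁)
    (hM₂ : IsRelMonodromyFiltration N₂ W₂ M₂) :
    IsRelMonodromyFiltration
      (TensorProduct.map N₁ LinearMap.id + TensorProduct.map LinearMap.id N₂)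
      (tensorFiltration K W₁ W₂) (tensorFiltration K M₁ M₂) := by
  have hN₁ : ShiftsDegree N₁ W₁ 0 := fun a b hb x hx => by
    rw [hb, add_zero]; exact hN₁W a x hx
  have hN₂ : ShiftsDegree N₂ W₂ 0 := fun a b hb x hx => by
    rw [hb, add_zero]; exact hN₂W a x hx
  have hNM₁ : ShiftsDegree N₁ M₁ (-2) := fun a b hb x hx => hb ▸ hM₁.2.1 a x hx
  have hNM₂ : ShiftsDegree N₂ M₂ (-2) := fun a b hb x hx => hb ▸ hM₂.2.1 a x hx
  obtain ⟨E₁, hE₁⟩ := hM₁.exists_isRaisingOperator hW₁ hN₁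
  obtain ⟨E₂, hE₂⟩ := hM₂.exists_isRaisingOperator hW₂ hN₂
  exact (hE₁.tensor hW₁ hW₂ hM₁.1 hM₂.1 hE₂).isRelMonodromyFiltration
    (tensorFiltration_mono hM₂.1) (hNM₁.tensorDerivation hNM₂) (hN₁.tensorDerivation hN₂)
end

section
/- Let σ be a finitely generated cone in a finite-dimensional ℝ-vector space E and σ′ a finitely generated cone in a finite-dimensional ℝ-vector space E′, and let f : σ′_ℝ → σ_ℝ be an ℝ-linear map with f(σ′) ⊆ σ. Let V be a finite-dimensional ℝ-vector space with a finite increasing filtration W, and let h : σ_ℝ → End_ℝ(V) be an ℝ-linear map such that h(N)(W_w) ⊆ W_w for all N ∈ σ_ℝ and all w, every h(N) with N ∈ σ is nilpotent, and h(N)h(N′) = h(N′)h(N) for all N, N′ ∈ σ. Assume that the family (M(τ))_τ, indexed by the faces τ of σ, witnesses admissibility of the action of σ on V via h with respect to W. For each face τ′ of σ′, let s(τ′) be a face of σ containing f(τ′) and contained in every face of σ containing f(τ′) (the smallest such face, which exists). Then the family (M(s(τ′)))_{τ′}, indexed by the faces τ′ of σ′, witnesses admissibility of the action of σ′ on V via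 h ∘ f with respect to W. -/
/-- A cone in an `ℝ`-vector space: contains `0`, closed under addition and under
multiplication by nonnegative reals. -/
def IsCone {E : Type*} [AddCommGroup E] [Module ℝ E] (σ : Set E) : Prop :=
  (0 : E) ∈ σ ∧ (∀ x ∈ σ, ∀ y ∈ σ, x + y ∈ σ) ∧ ∀ c : ℝ, 0 ≤ c → ∀ x ∈ σ, c • x ∈ σ

/-- A finitely generated cone. -/
def IsFinitelyGeneratedCone {E : Type*} [AddCommGroup E] [Module ℝ E] (σ : Set E) : Prop :=
  ∃ (n : ℕ) (g : Fin n → E),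
    σ = {x | ∃ c : Fin n → ℝ, (∀ i, 0 ≤ c i) ∧ x = ∑ i, c i • g i}

/-- `τ` is a face of the cone `σ`. -/
structure IsFace {E : Type*} [AddCommGroup E] [Module ℝ E] (σ τ : Set E) : Prop where
  cone : IsCone τ
  subset : τ ⊆ σ
  mem_of_add_mem : ∀ x ∈ σ, ∀ y ∈ σ, x + y ∈ τ → x ∈ τ ∧ y ∈ τ

/-- The family `(M τ)_τ`, indexed by the faces `τ` of `σ`, witnesses admissibility of the
action of the cone `σ` on `V` via the linear map `h : σ_ℝ → End_ℝ(V)` with respect to the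
filtration `W`. -/
def WitnessesAdmissibility {E V : Type*} [AddCommGroup E] [Module ℝ E]
    [AddCommGroup V] [Module ℝ V] (σ : Set E)
    (h : ↥(Submodule.span ℝ σ) →ₗ[ℝ] Module.End ℝ V)
    (W : ℤ → Submodule ℝ V) (M : Set E → ℤ → Submodule ℝ V) : Prop :=
  (∀ τ : Set E, IsFace σ τ → Monotone (M τ)) ∧
  M (σ ∩ {x : E | -x ∈ σ}) = W ∧
  (∀ τ : Set E, IsFace σ τ → ∀ (N : E) (hN : N ∈ σ), ∀ w : ℤ, ∀ x ∈ M τ w,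
    h ⟨N, Submodule.subset_span hN⟩ x ∈ M τ w) ∧
  (∀ (τ : Set E) (hτ : IsFace σ τ), ∀ (N : E) (hN : N ∈ τ), ∀ w : ℤ, ∀ x ∈ M τ w,
    h ⟨N, Submodule.subset_span (hτ.subset hN)⟩ x ∈ M τ (w - 2)) ∧
  ∀ τ τ' : Set E, IsFace σ τ → IsFace σ τ' → ∀ (N : E) (hN : N ∈ σ),
    τ ∪ {N} ⊆ τ' → (∀ ρ : Set E, IsFace σ ρ → τ ∪ {N} ⊆ ρ → τ' ⊆ ρ) →
    IsRelMonodromyFiltration (h ⟨N, Submodule.subset_span hN⟩) (M τ) (M τ')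

/-- The standing hypotheses on the linear map `h : σ_ℝ → End_ℝ(V)`: it preserves the
filtration `W`, `h(N)` is nilpotent for `N ∈ σ`, and the `h(N)`, `N ∈ σ`, commute. -/
def IsConeAction {E V : Type*} [AddCommGroup E] [Module ℝ E]
    [AddCommGroup V] [Module ℝ V] (σ : Set E)
    (h : ↥(Submodule.span ℝ σ) →ₗ[ℝ] Module.End ℝ V)
    (W : ℤ → Submodule ℝ V) : Prop :=
  (∀ N : ↥(Submodule.span ℝ σ), ∀ w : ℤ, ∀ x ∈ W w, h N x ∈ W w) ∧
  (∀ (N : E) (hN : N ∈ σ), IsNilpotent (h ⟨N, Submodule.subset_span hN⟩)) ∧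
  ∀ (N : E) (hN : N ∈ σ) (N' : E) (hN' : N' ∈ σ),
    Commute (h ⟨N, Submodule.subset_span hN⟩) (h ⟨N', Submodule.subset_span hN'⟩)

/-- The lineality space of a cone is a face. -/
theorem IsCone.isFace_lineality {E : Type*} [AddCommGroup E] [Module ℝ E] {σ : Set E}
    (hσ : IsCone σ) : IsFace σ (σ ∩ {x : E | -x ∈ σ}) where
  cone := by
    obtain ⟨h0, hadd, hsmul⟩ := hσ
    refine ⟨⟨h0, by simpa using h0⟩, fun x hx y hy => ⟨hadd x hx.1 y hy.1, ?_⟩,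
      fun c hc x hx => ⟨hsmul c hc x hx.1, ?_⟩⟩
    · have := hadd _ hx.2 _ hy.2
      rwa [← neg_add] at this
    · have := hsmul c hc _ hx.2
      rwa [smul_neg] at this
  subset := Set.inter_subset_left
  mem_of_add_mem := by
    rintro x hx y hy ⟨-, hxy⟩
    have hxy : -(x + y) ∈ σ := hxy
    refine ⟨⟨hx, ?_⟩, ⟨hy, ?_⟩⟩
    · have := hσ.2.1 _ hxy _ hy
      rwa [show -(x + y) + y = -x by abel] at this
    · have := hσ.2.1 _ hxy _ hx
      rwa [show -(x + y) + x = -y by abel] at this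

/-- The lineality space of a cone is contained in every face. -/
theorem IsFace.lineality_subset {E : Type*} [AddCommGroup E] [Module ℝ E] {σ τ : Set E}
    (hτ : IsFace σ τ) : σ ∩ {x : E | -x ∈ σ} ⊆ τ := fun x hx =>
  (hτ.mem_of_add_mem x hx.1 (-x) hx.2 (by simpa using hτ.cone.1)).1

/-- The preimage of a face under a linear map of cones is a face. -/
theorem IsFace.preimage {E E' : Type*} [AddCommGroup E] [Module ℝ E]
    [AddCommGroup E'] [Module ℝ E'] {σ ρ : Set E} {σ' : Set E'} (hσ' : IsCone σ')
    (f : ↥(Submodule.span ℝ σ') →ₗ[ℝ] ↥(Submodule.span ℝ σ))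
    (hf : ∀ (x : E') (hx : x ∈ σ'), (f ⟨x, Submodule.subset_span hx⟩ : E) ∈ σ)
    (hρ : IsFace σ ρ) :
    IsFace σ' {x | ∃ hx : x ∈ σ', (f ⟨x, Submodule.subset_span hx⟩ : E) ∈ ρ} := by
  have map_add_coe (x y : E') (hx : x ∈ σ') (hy : y ∈ σ') :
      (f ⟨x + y, Submodule.subset_span (hσ'.2.1 x hx y hy)⟩ : E) =
        f ⟨x, Submodule.subset_span hx⟩ + f ⟨y, Submodule.subset_span hy⟩ := by
    rw [← Submodule.coe_add, ← map_add]; rfl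
  refine ⟨⟨⟨hσ'.1, ?_⟩, ?_, ?_⟩, fun x hx => hx.1, ?_⟩
  · have : f ⟨0, Submodule.subset_span hσ'.1⟩ = 0 := map_zero f
    simpa [this] using hρ.cone.1
  · rintro x ⟨hx, hfx⟩ y ⟨hy, hfy⟩
    refine ⟨hσ'.2.1 x hx y hy, ?_⟩
    rw [map_add_coe x y hx hy]
    exact hρ.cone.2.1 _ hfx _ hfy
  · rintro c hc x ⟨hx, hfx⟩
    refine ⟨hσ'.2.2 c hc x hx, ?_⟩
    have : f ⟨c • x, Submodule.subset_span (hσ'.2.2 c hc x hx)⟩ =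
      c • f ⟨x, Submodule.subset_span hx⟩ := by rw [← map_smul]; rfl
    rw [this]
    exact hρ.cone.2.2 c hc _ hfx
  · rintro x hx y hy ⟨hxy, hfxy⟩
    rw [map_add_coe x y hx hy] at hfxy
    obtain ⟨h1, h2⟩ := hρ.mem_of_add_mem _ (hf x hx) _ (hf y hy) hfxy
    exact ⟨⟨hx, h1⟩, ⟨hy, h2⟩⟩

/-- admissibility pulls back along a linear map `f : σ'_ℝ → σ_ℝ` with
`f(σ') ⊆ σ`; the relative monodromy filtration of a face `τ'` of `σ'` is that of the smallest
face of `σ` containing `f(τ')`. -/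
theorem admissibility_pullback
    {E E' V : Type*} [AddCommGroup E] [Module ℝ E] [FiniteDimensional ℝ E]
    [AddCommGroup E'] [Module ℝ E'] [FiniteDimensional ℝ E']
    [AddCommGroup V] [Module ℝ V] [FiniteDimensional ℝ V]
    (σ : Set E) (hσcone : IsCone σ) (hσfg : IsFinitelyGeneratedCone σ)
    (σ' : Set E') (hσ'cone : IsCone σ') (hσ'fg : IsFinitelyGeneratedCone σ')
    (f : ↥(Submodule.span ℝ σ') →ₗ[ℝ] ↥(Submodule.span ℝ σ))
    (hfσ' : ∀ (x : E') (hx : x ∈ σ'), ((f ⟨x, Submodule.subset_span hx⟩ : ↥(Submodule.span ℝ σ)) : E) ∈ σ)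
    (W : ℤ → Submodule ℝ V) (hW : IsFiniteFiltration W)
    (h : ↥(Submodule.span ℝ σ) →ₗ[ℝ] Module.End ℝ V)
    (hact : IsConeAction σ h W)
    (M : Set E → ℤ → Submodule ℝ V)
    (hM : WitnessesAdmissibility σ h W M)
    (s : Set E' → Set E)
    (hs : ∀ (τ' : Set E') (hτ' : IsFace σ' τ'),
      IsFace σ (s τ') ∧
      (∀ (x : E') (hx : x ∈ τ'),
        ((f ⟨x, Submodule.subset_span (hτ'.subset hx)⟩ : ↥(Submodule.span ℝ σ)) : E) ∈ s τ') ∧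
      (∀ ρ : Set E, IsFace σ ρ →
        (∀ (x : E') (hx : x ∈ τ'),
          ((f ⟨x, Submodule.subset_span (hτ'.subset hx)⟩ : ↥(Submodule.span ℝ σ)) : E) ∈ ρ) →
        s τ' ⊆ ρ)) :
    WitnessesAdmissibility σ' (h ∘ₗ f) W (fun τ' => M (s τ')) := by
  obtain ⟨hmono, hbot, hpres, hshift, hrel⟩ := hM
  refine ⟨fun τ hτ => hmono _ (hs τ hτ).1, ?_,
    fun τ hτ N hN => hpres _ (hs τ hτ).1 _ (hfσ' N hN),
    fun τ hτ N hN => hshift _ (hs τ hτ).1 _ ((hs τ hτ).2.1 N hN), ?_⟩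
  · obtain ⟨hface, -, hmin⟩ := hs _ hσ'cone.isFace_lineality
    have hs_lineality : s (σ' ∩ {x : E' | -x ∈ σ'}) = σ ∩ {x : E | -x ∈ σ} := by
      refine (hmin _ hσcone.isFace_lineality fun x hx => ?_).antisymm hface.lineality_subset
      exact ((hσcone.isFace_lineality.preimage hσ'cone f hfσ').lineality_subset hx).2
    simp only [hs_lineality, hbot]
  · intro τ τ' hτ hτ' N hN hsub hmin
    obtain ⟨hface, hmem, hle⟩ := hs τ hτ
    obtain ⟨hface', hmem', hle'⟩ := hs τ' hτ'
    refine hrel _ _ hface hface' _ (hfσ' N hN) ?_ fun ρ hρ hρsub => hle' ρ hρ fun x hx => ?_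
    · exact Set.union_subset (hle _ hface' fun x hx => hmem' x (hsub (Or.inl hx)))
        (Set.singleton_subset_iff.2 (hmem' N (hsub (Or.inr rfl))))
    · refine (hmin _ (hρ.preimage hσ'cone f hfσ') ?_ hx).2
      rintro y (hy | rfl)
      · exact ⟨hτ.subset hy, hρsub (Or.inl (hmem y hy))⟩
      · exact ⟨hN, hρsub (Or.inr rfl)⟩
end

section
/- Let Γ be a group acting by homeomorphisms on a topological space X, let Y be a set with a Γ-action, and let f : X → Y be a Γ-equivariant surjection. Let Γ′ be a subgroup of Γ. Endow Γ′\Y and Γ\Y with the quotient topologies of X, and endow Γ′\X and Γ\X with their quotient topologies. Let V be an open subset of Γ′\Y and let U be the inverse image of V under the induced map Γ′\X → Γ′\Y. Assume: (1) the quotient map X → Γ\X is a local homeomorphism and Γ\X is Hausdorff; (2) the induced map U → V (with the subspace topologies) is proper; (3) whenever x ∈ X and γ ∈ Γ are such that the images of γ·x and of x in Γ′\Y are both contained in V and coincide, one has γ ∈ Γ′. Then the restriction to V of the canonical map Γ′\Y → Γ\Y is a local homeomorphism. -/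
open Topology

section

variable {Γ : Type*} {X : Type*} {Y : Type*} [Group Γ] [MulAction Γ X] [MulAction Γ Y]

/-- The map `Γ′\X → Γ′\Y` induced by a `Γ`-equivariant map `f : X → Y`. -/
def inducedQuotMap (Γ' : Subgroup Γ) (f : X → Y)
    (hf : ∀ (γ : Γ) (x : X), f (γ • x) = γ • f x) :
    Quotient (MulAction.orbitRel Γ' X) → Quotient (MulAction.orbitRel Γ' Y) :=
  Quotient.lift (fun x => Quotient.mk (MulAction.orbitRel Γ' Y) (f x)) (by
    intro a b hab
    obtain ⟨γ, hγ⟩ := hab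
    refine Quotient.sound ⟨γ, ?_⟩
    show (γ : Γ) • f b = f a
    rw [← hf (γ : Γ) b, ← hγ]
    rfl)

/-- The canonical map `Γ′\Y → Γ\Y` for a subgroup `Γ′` of `Γ`. -/
def subquotToQuot (Γ' : Subgroup Γ) :
    Quotient (MulAction.orbitRel Γ' Y) → Quotient (MulAction.orbitRel Γ Y) :=
  Quotient.lift (fun y => Quotient.mk (MulAction.orbitRel Γ Y) y) (by
    intro a b hab
    obtain ⟨γ, hγ⟩ := hab
    exact Quotient.sound ⟨(γ : Γ), hγ⟩)

variable [TopologicalSpace X]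

/-- The quotient topology of `X` on `Γ′\Y`, for a `Γ`-set `Y` and a map `f : X → Y`. -/
def quotTopOfMap (Γ' : Subgroup Γ) (f : X → Y) :
    TopologicalSpace (Quotient (MulAction.orbitRel Γ' Y)) :=
  TopologicalSpace.coinduced
    (fun x : X => Quotient.mk (MulAction.orbitRel Γ' Y) (f x)) inferInstance

/-- The quotient topology of `X` on `Γ\Y`, for a `Γ`-set `Y` and a map `f : X → Y`. -/
def quotTopOfMapFull (f : X → Y) :
    TopologicalSpace (Quotient (MulAction.orbitRel Γ Y)) :=
  TopologicalSpace.coinduced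
    (fun x : X => Quotient.mk (MulAction.orbitRel Γ Y) (f x)) inferInstance

/-- A continuous, open, locally injective map is a local homeomorphism. -/
lemma IsLocallyInjective.isLocalHomeomorph {A B : Type*} [TopologicalSpace A]
    [TopologicalSpace B] {g : A → B} (hinj : IsLocallyInjective g) (hcont : Continuous g)
    (hopen : IsOpenMap g) : IsLocalHomeomorph g := by
  refine isLocalHomeomorph_iff_isOpenEmbedding_restrict.2 fun a => ?_
  obtain ⟨U, hU, haU, hUinj⟩ := hinj a
  exact ⟨U, hU.mem_nhds haU, .of_continuous_injective_isOpenMap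
    (hcont.comp continuous_subtype_val) hUinj.injective (hopen.comp hU.isOpenMap_subtype_val)⟩

/-- If `p` is continuous and locally injective with Hausdorff target, and is injective on a fiber
of a proper map `g`, then it is injective on the preimage under `g` of some open neighborhood. -/
lemma IsProperMap.exists_injOn_preimage {A B C : Type*} [TopologicalSpace A]
    [TopologicalSpace B] [TopologicalSpace C] [T2Space C] {g : A → B} {p : A → C}
    (hg : IsProperMap g) (hcont : Continuous p) (hinj : IsLocallyInjective p) {b : B}
    (hb : Set.InjOn p (g ⁻¹' {b})) :
    ∃ W, IsOpen W ∧ b ∈ W ∧ Set.InjOn p (g ⁻¹' W) := by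
  obtain ⟨N, hN, hNinj⟩ := hb.exists_mem_nhdsSet (hg.isCompact_preimage isCompact_singleton)
    (fun _ _ => hcont.continuousAt) (fun a _ => isLocallyInjective_iff_nhds.1 hinj a)
  rw [← hg.isClosedMap.comap_nhds_eq hg.continuous b, Filter.mem_comap] at hN
  obtain ⟨T, hT, hTN⟩ := hN
  obtain ⟨W, hWT, hW, hbW⟩ := mem_nhds_iff.1 hT
  exact ⟨W, hW, hbW, hNinj.mono ((Set.preimage_mono hWT).trans hTN)⟩

/-- If `X → Γ\X` is locally injective, then so is `Γ′\X → Γ\X`. -/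
lemma isLocallyInjective_subquotToQuot [ContinuousConstSMul Γ X] (Γ' : Subgroup Γ)
    (h : IsLocallyInjective fun x : X => Quotient.mk (MulAction.orbitRel Γ X) x) :
    IsLocallyInjective (subquotToQuot (Y := X) Γ') := by
  rintro ⟨x⟩
  have : ContinuousConstSMul Γ' X := ⟨fun γ => continuous_const_smul (γ : Γ)⟩
  obtain ⟨O, hO, hxO, hinj⟩ := h x
  refine ⟨Quotient.mk (MulAction.orbitRel Γ' X) '' O,
    (MulAction.isOpenQuotientMap_quotientMk (Γ := Γ')).isOpenMap O hO, ⟨x, hxO, rfl⟩, ?_⟩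
  rintro _ ⟨a, ha, rfl⟩ _ ⟨b, hb, rfl⟩ hab
  exact congrArg _ (hinj ha hb hab)

lemma continuous_subquotToQuot (Γ' : Subgroup Γ) :
    Continuous (subquotToQuot (Y := X) Γ') :=
  continuous_quot_mk.quotient_lift _

lemma isOpenMap_subquotToQuot_quotTopOfMap [ContinuousConstSMul Γ X] (Γ' : Subgroup Γ)
    (f : X → Y) (hf : ∀ (γ : Γ) (x : X), f (γ • x) = γ • f x) :
    @IsOpenMap _ _ (quotTopOfMap Γ' f) (quotTopOfMapFull f)
      (subquotToQuot (Γ := Γ) (Y := Y) Γ') := by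
  intro W hW
  have hW' : IsOpen ((fun x : X => Quotient.mk (MulAction.orbitRel Γ' Y) (f x)) ⁻¹' W) := hW
  change IsOpen ((fun x : X => Quotient.mk (MulAction.orbitRel Γ Y) (f x)) ⁻¹'
    (subquotToQuot Γ' '' W))
  convert isOpen_iUnion fun γ : Γ => hW'.preimage (continuous_const_smul γ)
  ext x
  simp only [Set.mem_preimage, Set.mem_image, Set.mem_iUnion]
  constructor
  · rintro ⟨⟨y⟩, hy, hyx⟩
    obtain ⟨γ, hγ : γ • f x = y⟩ := Quotient.exact hyx
    refine ⟨γ, ?_⟩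
    rw [hf, hγ]
    exact hy
  · rintro ⟨γ, hγ⟩
    exact ⟨_, hγ, Quotient.sound ⟨γ, (hf γ x).symm⟩⟩

/-- under the hypotheses (1)–(3), the restriction to `V` of the canonical map
`Γ′\Y → Γ\Y` is a local homeomorphism. -/
theorem local_homeomorph_of_quotients
    (hhomeo : ∀ γ : Γ, Continuous fun x : X => γ • x)
    (f : X → Y) (hf : ∀ (γ : Γ) (x : X), f (γ • x) = γ • f x)
    (hsurj : Function.Surjective f)
    (Γ' : Subgroup Γ)
    (V : Set (Quotient (MulAction.orbitRel Γ' Y)))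
    (hVopen : IsOpen[quotTopOfMap Γ' f] V)
    (h1 : IsLocalHomeomorph fun x : X => Quotient.mk (MulAction.orbitRel Γ X) x)
    (h1' : T2Space (Quotient (MulAction.orbitRel Γ X)))
    (h2 : @IsProperMap ↥((inducedQuotMap Γ' f hf) ⁻¹' V) ↥V
      inferInstance (TopologicalSpace.induced Subtype.val (quotTopOfMap Γ' f))
      (fun u => ⟨inducedQuotMap Γ' f hf u.1, u.2⟩))
    (h3 : ∀ (x : X) (γ : Γ),
      Quotient.mk (MulAction.orbitRel Γ' Y) (f (γ • x)) ∈ V →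
      Quotient.mk (MulAction.orbitRel Γ' Y) (f x) ∈ V →
      Quotient.mk (MulAction.orbitRel Γ' Y) (f (γ • x)) =
        Quotient.mk (MulAction.orbitRel Γ' Y) (f x) →
      γ ∈ Γ') :
    @IsLocalHomeomorph ↥V (Quotient (MulAction.orbitRel Γ Y))
      (TopologicalSpace.induced Subtype.val (quotTopOfMap Γ' f))
      (quotTopOfMapFull f)
      (fun v => subquotToQuot Γ' v.1) := by
  have : ContinuousConstSMul Γ X := ⟨hhomeo⟩
  let _ : TopologicalSpace (Quotient (MulAction.orbitRel Γ' Y)) := quotTopOfMap Γ' f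
  let _ : TopologicalSpace (Quotient (MulAction.orbitRel Γ Y)) := quotTopOfMapFull f
  have hcont : Continuous (subquotToQuot (Γ := Γ) (Y := Y) Γ') :=
    continuous_coinduced_dom.2 continuous_coinduced_rng
  refine IsLocallyInjective.isLocalHomeomorph ?_ (hcont.comp continuous_subtype_val)
    ((isOpenMap_subquotToQuot_quotTopOfMap Γ' f hf).comp hVopen.isOpenMap_subtype_val)
  intro v
  have hfiber : Set.InjOn
      (fun u : ↥(inducedQuotMap Γ' f hf ⁻¹' V) => subquotToQuot (Γ := Γ) Γ' u.1)
      ((fun u => (⟨inducedQuotMap Γ' f hf u.1, u.2⟩ : V)) ⁻¹' {v}) := by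
    rintro ⟨⟨a⟩, ha⟩ hav ⟨⟨b⟩, hb⟩ hbv hab
    obtain ⟨γ, hγ : γ • b = a⟩ := Quotient.exact hab
    subst hγ
    have hγ' : γ ∈ Γ' := h3 b γ ha hb (congrArg Subtype.val (hav.trans hbv.symm))
    exact Subtype.ext (Quotient.sound ⟨⟨γ, hγ'⟩, rfl⟩)
  obtain ⟨W, hW, hvW, hWinj⟩ := h2.exists_injOn_preimage
    ((continuous_subquotToQuot Γ').comp continuous_subtype_val)
    ((isLocallyInjective_subquotToQuot Γ' h1.isLocallyInjective).comp_right
      continuous_subtype_val Subtype.val_injective) hfiber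
  refine ⟨W, hW, hvW, ?_⟩
  rintro ⟨⟨y₁⟩, hy₁⟩ hw₁ ⟨⟨y₂⟩, hy₂⟩ hw₂ hy
  obtain ⟨γ, hγ : γ • y₂ = y₁⟩ := Quotient.exact hy
  obtain ⟨x, rfl⟩ := hsurj y₂
  rw [← hf] at hγ
  subst hγ
  have hx := @hWinj ⟨Quotient.mk _ (γ • x), hy₁⟩ hw₁ ⟨Quotient.mk _ x, hy₂⟩ hw₂
    (Quotient.sound ⟨γ, rfl⟩)
  exact Subtype.ext (congrArg
    (fun u : ↥(inducedQuotMap Γ' f hf ⁻¹' V) => inducedQuotMap Γ' f hf u.1) hx)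

end
end
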